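/- Let B be an instance of (2,2)-E3-SAT, let J be the TAP-SS instance constructed from B as described, and let J′ be the extended TAP-SS instance obtained from J by the gadget construction described. If J′ admits a stable matching, then B admits a satisfying truth assignment. -/

import Mathlib

/-- The three subjects. -/
inductive Subj : Type where
  | F | I | M
deriving DecidableEq

/-- An instance of (2,2)-E3-SAT with variables `Fin n` and clauses `Fin m`:
`clause j t` is the literal (variable, polarity) in position `t` of clause `j`;
`occurs v b o` is the (clause, position) of the `o`-th occurrence of the literal
`(v, b)`, and `occInv` is its two-sided inverse, so that each clause has exactly
3 literals and each literal occurs exactly twice. -/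
structure E3SAT (n m : ℕ) where
  clause : Fin m → Fin 3 → Fin n × Bool
  occurs : Fin n → Bool → Fin 2 → Fin m × Fin 3
  occInv : Fin m → Fin 3 → Fin n × Bool × Fin 2
  clause_occurs : ∀ v b o, clause (occurs v b o).1 (occurs v b o).2 = (v, b)
  occurs_occInv : ∀ j t, occurs (occInv j t).1 (occInv j t).2.1 (occInv j t).2.2 = (j, t)
  occInv_occurs : ∀ v b o, occInv (occurs v b o).1 (occurs v b o).2 = (v, b, o)

/-- `f` is a satisfying truth assignment of `B`. -/
def E3SAT.Satisfies {n m : ℕ} (B : E3SAT n m) (f : Fin n → Bool) : Prop :=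
  ∀ j : Fin m, ∃ t : Fin 3, f (B.clause j t).1 = (B.clause j t).2
/-- An instance of TAP-SS: like TAP but each school has a separate preference
list of applicants for each subject. -/
structure TAPSS (A : Type*) (S : Type*) (P : Type*) where
  ptype : A → Finset P
  prefA : A → List S
  cap : S → P → ℕ
  prefSp : S → P → List A

namespace TAPSS

variable {A S P : Type*} [DecidableEq A] [DecidableEq S] [DecidableEq P] (J : TAPSS A S P)

def IsAssignment (M : Finset (A × S)) : Prop :=
  (∀ x ∈ M, x.2 ∈ J.prefA x.1) ∧
  ∀ a s s', (a, s) ∈ M → (a, s') ∈ M → s = s'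

def Mp (M : Finset (A × S)) (s : S) (p : P) : Finset A :=
  (M.filter (fun x => x.2 = s ∧ p ∈ J.ptype x.1)).image Prod.fst

def Mpr (M : Finset (A × S)) (s : S) (p r : P) : Finset A :=
  (M.filter (fun x => x.2 = s ∧ J.ptype x.1 = {p, r})).image Prod.fst

def IsMatching (M : Finset (A × S)) : Prop :=
  J.IsAssignment M ∧ ∀ s p, (J.Mp M s p).card ≤ J.cap s p

def Undersub (M : Finset (A × S)) (s : S) (p : P) : Prop :=
  (J.Mp M s p).card < J.cap s p

def PrefersA (a : A) (s s' : S) : Prop :=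
  s ∈ J.prefA a ∧ s' ∈ J.prefA a ∧ (J.prefA a).idxOf s < (J.prefA a).idxOf s'

/-- School `s` prefers `a` to `a'` in subject `p`. -/
def PrefersS (s : S) (p : P) (a a' : A) : Prop :=
  a ∈ J.prefSp s p ∧ a' ∈ J.prefSp s p ∧
    (J.prefSp s p).idxOf a < (J.prefSp s p).idxOf a'

def Unassigned (M : Finset (A × S)) (a : A) : Prop := ∀ s, (a, s) ∉ M

def Blocks (M : Finset (A × S)) (a : A) (s : S) : Prop :=
  s ∈ J.prefA a ∧
  (Unassigned M a ∨ ∃ s', (a, s') ∈ M ∧ J.PrefersA a s s') ∧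
  ∃ p₁ p₂, p₁ ≠ p₂ ∧ J.ptype a = {p₁, p₂} ∧
    ((J.Undersub M s p₁ ∧ J.Undersub M s p₂) ∨
     (J.Undersub M s p₁ ∧ ∃ b ∈ J.Mp M s p₂, J.PrefersS s p₂ a b) ∨
     (J.Undersub M s p₂ ∧ ∃ b ∈ J.Mp M s p₁, J.PrefersS s p₁ a b) ∨
     (∃ b ∈ J.Mpr M s p₁ p₂, J.PrefersS s p₁ a b ∧ J.PrefersS s p₂ a b) ∨
     (∃ b₁ ∈ J.Mp M s p₁, ∃ b₂ ∈ J.Mp M s p₂,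
        b₁ ≠ b₂ ∧ J.PrefersS s p₁ a b₁ ∧ J.PrefersS s p₂ a b₂))

def Stable (M : Finset (A × S)) : Prop :=
  J.IsMatching M ∧ ∀ a s, ¬ J.Blocks M a s

/-- Every applicant is assigned. -/
def ApplicantComplete (_J : TAPSS A S P) (M : Finset (A × S)) : Prop :=
  ∀ a : A, ∃ s, (a, s) ∈ M

end TAPSS
/-- The applicants of the TAP-SS instance constructed from a (2,2)-E3-SAT instance:
`x i r` is the applicant `x_{4i+r}` of the paper, `q j` is `q_{j+1}` and
`w j t` is `w_{j+1}^{t+1}`. -/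
inductive SApp (n m : ℕ) : Type where
  | x (i : Fin n) (r : Fin 4)
  | q (j : Fin m)
  | w (j : Fin m) (t : Fin 3)
deriving DecidableEq

/-- The schools of the TAP-SS instance constructed from a (2,2)-E3-SAT instance:
`y i r` is the school `y_{4i+r}` of the paper, `s j t` is `s_{j+1}^{t+1}` and
`s4 j` is `s_{j+1}^4`. -/
inductive SSch (n m : ℕ) : Type where
  | y (i : Fin n) (r : Fin 4)
  | s (j : Fin m) (t : Fin 3)
  | s4 (j : Fin m)
deriving DecidableEq

variable {n m : ℕ}

/-- The school `s(x_{4i+r})` housing the literal occurrence that applicant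
`x_{4i+r}` corresponds to. -/
def sx (B : E3SAT n m) (i : Fin n) (r : Fin 4) : SSch n m :=
  if h : r.1 < 2 then
    SSch.s (B.occurs i true ⟨r.1, h⟩).1 (B.occurs i true ⟨r.1, h⟩).2
  else
    SSch.s (B.occurs i false ⟨r.1 - 2, by have := r.2; omega⟩).1
      (B.occurs i false ⟨r.1 - 2, by have := r.2; omega⟩).2

open Subj in
/-- Types of the applicants: all x-applicants are FI, all q- and w-applicants are FM. -/
def ssPtype : SApp n m → Finset Subj
  | .x _ _ => {F, I}
  | .q _ => {F, M}
  | .w _ _ => {F, M}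

/-- Preference lists of the applicants. -/
def ssPrefA (B : E3SAT n m) : SApp n m → List (SSch n m)
  | .x i r =>
      if r = 0 then [.y i 0, sx B i r, .y i 1]
      else if r = 1 then [.y i 1, sx B i r, .y i 2]
      else if r = 2 then [.y i 3, sx B i r, .y i 2]
      else [.y i 0, sx B i r, .y i 3]
  | .q j => [.s j 0, .s j 1, .s j 2]
  | .w j t => [.s j t, .s4 j]

open Subj in
/-- Capacities of the schools. -/
def ssCap : SSch n m → Subj → ℕ
  | .y _ _, p => if p = M then 0 else 1
  | .s _ _, _ => 1
  | .s4 _, p => if p = I then 0 else 1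

/-- `⟨X⟩`: the x-applicants in increasing subscript order. -/
def Xlist (n m : ℕ) : List (SApp n m) :=
  (List.finRange n).flatMap fun i => (List.finRange 4).map fun r => SApp.x i r

/-- `⟨Q⟩`: the q-applicants in increasing subscript order. -/
def Qlist (n m : ℕ) : List (SApp n m) := (List.finRange m).map SApp.q

/-- `⟨W⟩`: the w-applicants ordered by increasing subscript and, within equal
subscript, increasing superscript. -/
def Wlist (n m : ℕ) : List (SApp n m) :=
  (List.finRange m).flatMap fun j => (List.finRange 3).map fun t => SApp.w j t

open Subj in
/-- The subject-specific master lists of applicants: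
F: ⟨W⟩ ⟨X⟩ ⟨Q⟩; I: ⟨X̄⟩; M: ⟨Q⟩ ⟨W̄⟩. -/
def ssMaster (n m : ℕ) : Subj → List (SApp n m)
  | F => Wlist n m ++ Xlist n m ++ Qlist n m
  | I => (Xlist n m).reverse
  | M => Qlist n m ++ (Wlist n m).reverse

/-- The TAP-SS instance `J` constructed from the (2,2)-E3-SAT instance `B`;
each school's preference list for subject `p` is the restriction of the master
list for `p` to the applicants whose type includes `p` and who find the school
acceptable. -/
def ssOf (B : E3SAT n m) : TAPSS (SApp n m) (SSch n m) Subj where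
  ptype := ssPtype
  prefA := ssPrefA B
  cap s p := ssCap s p
  prefSp s p := (ssMaster n m p).filter
    (fun a => decide (s ∈ ssPrefA B a) && decide (p ∈ ssPtype a))

/-- The set of pairs `T_i = {(x_{4i+r}, y_{4i+r}) : 0 ≤ r ≤ 3}`. -/
def ssT (i : Fin n) : Finset (SApp n m × SSch n m) :=
  {(.x i 0, .y i 0), (.x i 1, .y i 1), (.x i 2, .y i 2), (.x i 3, .y i 3)}

/-- The set of pairs `F_i = {(x_{4i+r}, y_{4i+r+1}) : 0 ≤ r ≤ 2} ∪ {(x_{4i+3}, y_{4i})}`. -/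
def ssF (i : Fin n) : Finset (SApp n m × SSch n m) :=
  {(.x i 0, .y i 1), (.x i 1, .y i 2), (.x i 2, .y i 3), (.x i 3, .y i 0)}
/-- The applicants of the extended instance `J′`: `base a` is an original applicant
`a` of `J`, and `p1 a`, `p2 a` are the new applicants `a′` and `a″`. -/
inductive SApp' (n m : ℕ) : Type where
  | base (a : SApp n m)
  | p1 (a : SApp n m)
  | p2 (a : SApp n m)
deriving DecidableEq

/-- The schools of the extended instance `J′`: `base s` is an original school of
`J`, and `g a` is the new school `g(a)` for each original applicant `a`. -/
inductive SSch' (n m : ℕ) : Type where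
  | base (s : SSch n m)
  | g (a : SApp n m)
deriving DecidableEq

open Subj in
/-- Types in `J′`: original applicants keep their types; if `a` has type FI then
`a′` has type FM, and if `a` has type FM then `a′` has type FI; `a″` always has
type IM. -/
def ssPtype' : SApp' n m → Finset Subj
  | .base a => ssPtype a
  | .p1 a => match a with
      | .x _ _ => {F, M}
      | _ => {F, I}
  | .p2 _ => {I, M}

/-- Preference lists in `J′`: `g a` is appended to `a`'s preference list, and the
new applicants `a′`, `a″` find only `g a` acceptable. -/
def ssPrefA' (B : E3SAT n m) : SApp' n m → List (SSch' n m)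
  | .base a => (ssPrefA B a).map SSch'.base ++ [.g a]
  | .p1 a => [.g a]
  | .p2 a => [.g a]

/-- Capacities in `J′`: original schools keep their capacities and each new school
`g a` has capacity 1 in every subject. -/
def ssCap' : SSch' n m → Subj → ℕ
  | .base s, p => ssCap s p
  | .g _, _ => 1

open Subj in
/-- The subject-specific master lists of `J′`:
F: ⟨W⟩ ⟨X⟩ ⟨Q⟩ ⟨X′⟩ ⟨R′⟩; I: ⟨X″⟩ ⟨R′⟩ ⟨R″⟩ ⟨X̄⟩; M: ⟨R″⟩ ⟨Q⟩ ⟨W̄⟩ ⟨X′⟩ ⟨X″⟩,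
where `LX1 = ⟨X′⟩`, `LX2 = ⟨X″⟩`, `LR1 = ⟨R′⟩`, `LR2 = ⟨R″⟩` are the chosen fixed
orderings of the sets of new applicants. -/
def ssMaster' (n m : ℕ) (LX1 LX2 LR1 LR2 : List (SApp' n m)) : Subj → List (SApp' n m)
  | F => (Wlist n m ++ Xlist n m ++ Qlist n m).map SApp'.base ++ LX1 ++ LR1
  | I => LX2 ++ LR1 ++ LR2 ++ ((Xlist n m).reverse).map SApp'.base
  | M => LR2 ++ (Qlist n m ++ (Wlist n m).reverse).map SApp'.base ++ LX1 ++ LX2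

/-- The extended TAP-SS instance `J′` constructed from `B` (with chosen orderings
of the new applicants); each school's preference list for subject `p` is the
restriction of the master list for `p` to the applicants whose type includes `p`
and who find the school acceptable. -/
def ssOf' (B : E3SAT n m) (LX1 LX2 LR1 LR2 : List (SApp' n m)) :
    TAPSS (SApp' n m) (SSch' n m) Subj where
  ptype := ssPtype'
  prefA := ssPrefA' B
  cap s p := ssCap' s p
  prefSp s p := (ssMaster' n m LX1 LX2 LR1 LR2 p).filter
    (fun a => decide (s ∈ ssPrefA' B a) && decide (p ∈ ssPtype' a))

/-- The hypothesis that `LX1, LX2, LR1, LR2` are indeed orderings of the sets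
`X′`, `X″`, `R′` and `R″` respectively. -/
def ssOrderings (n m : ℕ) (LX1 LX2 LR1 LR2 : List (SApp' n m)) : Prop :=
  LX1.Perm ((Xlist n m).map SApp'.p1) ∧ LX2.Perm ((Xlist n m).map SApp'.p2) ∧
  LR1.Perm ((Qlist n m ++ Wlist n m).map SApp'.p1) ∧
  LR2.Perm ((Qlist n m ++ Wlist n m).map SApp'.p2)
theorem List.idxOf_filter_append_lt {A : Type*} [DecidableEq A] (P : A → Bool) {L₁ L₂ : List A}
    {a b : A} (ha : a ∈ L₁) (hPa : P a) (hb : b ∉ L₁) :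
    ((L₁ ++ L₂).filter P).idxOf a < ((L₁ ++ L₂).filter P).idxOf b := by
  have ha' : a ∈ L₁.filter P := List.mem_filter.2 ⟨ha, hPa⟩
  have hb' : b ∉ L₁.filter P := fun h => hb (List.mem_filter.1 h).1
  rw [List.filter_append, List.idxOf_append_of_mem ha', List.idxOf_append_of_notMem hb']
  have := List.idxOf_lt_length_of_mem ha'
  omega

namespace TAPSS

section General

variable {A S P : Type*} [DecidableEq A] [DecidableEq S] [DecidableEq P] {J : TAPSS A S P}
  {M : Finset (A × S)}

theorem mem_Mp {s : S} {p : P} {a : A} : a ∈ J.Mp M s p ↔ (a, s) ∈ M ∧ p ∈ J.ptype a := by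
  simp only [Mp, Finset.mem_image, Finset.mem_filter, Prod.exists, exists_and_right,
    exists_eq_right]
  constructor
  · rintro ⟨x, h, rfl, h'⟩
    exact ⟨h, h'⟩
  · rintro ⟨h, h'⟩
    exact ⟨s, h, rfl, h'⟩

theorem undersub_of_forall_notMem {s : S} {p : P} (hc : 0 < J.cap s p)
    (h : ∀ a, (a, s) ∈ M → p ∉ J.ptype a) : J.Undersub M s p := by
  have : J.Mp M s p = ∅ :=
    Finset.eq_empty_of_forall_notMem fun a ha => h a (mem_Mp.1 ha).1 (mem_Mp.1 ha).2
  rw [Undersub, this]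
  exact hc

theorem IsMatching.eq_of_cap_le_one (hM : J.IsMatching M) {s : S} {p : P} (hc : J.cap s p ≤ 1)
    {a b : A} (ha : (a, s) ∈ M) (hb : (b, s) ∈ M) (hpa : p ∈ J.ptype a) (hpb : p ∈ J.ptype b) :
    a = b :=
  Finset.card_le_one.1 ((hM.2 s p).trans hc) a (mem_Mp.2 ⟨ha, hpa⟩) b (mem_Mp.2 ⟨hb, hpb⟩)

/-- In a stable matching, no applicant who would move to `s` meets a school `s` with a free place
in one of the applicant's subjects and a less preferred applicant in the other one. -/
theorem Stable.false_of_prefersS (hst : J.Stable M) {a b : A} {s : S} {p q : P}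
    (hs : s ∈ J.prefA a) (hmove : Unassigned M a ∨ ∃ s', (a, s') ∈ M ∧ J.PrefersA a s s')
    (hpq : p ≠ q) (ht : J.ptype a = {p, q}) (hu : J.Undersub M s p)
    (hb : (b, s) ∈ M) (hqb : q ∈ J.ptype b) (hab : J.PrefersS s q a b) : False :=
  hst.2 a s ⟨hs, hmove, p, q, hpq, ht, Or.inr (Or.inl ⟨hu, b, mem_Mp.2 ⟨hb, hqb⟩, hab⟩)⟩

/-- A school of unit capacities attracting three applicants with cyclic types and cyclic
preferences forces the first of them to be assigned elsewhere. -/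
theorem Stable.exists_ne_of_cyclic (hst : J.Stable M) {a b c : A} {g : S} {p q r : P}
    (hpq : p ≠ q) (hqr : q ≠ r) (hrp : r ≠ p) (hcap : ∀ u, J.cap g u = 1)
    (hta : J.ptype a = {p, q}) (htb : J.ptype b = {q, r}) (htc : J.ptype c = {r, p})
    (hga : g ∈ J.prefA a) (hgb : J.prefA b = [g]) (hgc : J.prefA c = [g])
    (hg : ∀ d, g ∈ J.prefA d → d = a ∨ d = b ∨ d = c)
    (hab : J.PrefersS g q a b) (hbc : J.PrefersS g r b c) (hca : J.PrefersS g p c a) :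
    ∃ s, s ≠ g ∧ (a, s) ∈ M := by
  have hM := hst.1
  have only : ∀ d, J.prefA d = [g] → (d, g) ∉ M → Unassigned M d := by
    intro d hd hdg s hs
    have := hM.1.1 _ hs
    rw [hd, List.mem_singleton] at this
    exact hdg (this ▸ hs)
  have occ : ∀ d, (d, g) ∈ M → d = a ∨ d = b ∨ d = c := fun d hd => hg d (hM.1.1 _ hd)
  have ne_ab : a ≠ b := by rintro rfl; exact absurd hab.2.2 (lt_irrefl _)
  have ne_bc : b ≠ c := by rintro rfl; exact absurd hbc.2.2 (lt_irrefl _)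
  have ne_ca : c ≠ a := by rintro rfl; exact absurd hca.2.2 (lt_irrefl _)
  have hub : ∀ u, 0 < J.cap g u := fun u => by rw [hcap u]; exact one_pos
  have not_ab : (a, g) ∈ M → (b, g) ∉ M := fun h h' =>
    ne_ab (hM.eq_of_cap_le_one (hcap q).le h h' (by simp [hta]) (by simp [htb]))
  have not_bc : (b, g) ∈ M → (c, g) ∉ M := fun h h' =>
    ne_bc (hM.eq_of_cap_le_one (hcap r).le h h' (by simp [htb]) (by simp [htc]))
  have not_ca : (c, g) ∈ M → (a, g) ∉ M := fun h h' =>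
    ne_ca (hM.eq_of_cap_le_one (hcap p).le h h' (by simp [htc]) (by simp [hta]))
  have ha : (a, g) ∉ M := by
    intro ha
    have hc : (c, g) ∉ M := fun h => not_ca h ha
    refine hst.false_of_prefersS (by simp [hgc]) (Or.inl (only c hgc hc)) hrp htc
      (undersub_of_forall_notMem (hub r) fun d hd => ?_) ha (by simp [hta]) hca
    rcases occ d hd with rfl | rfl | rfl
    · simp [hta, hrp, hqr.symm]
    · exact absurd hd (not_ab ha)
    · exact absurd hd hc
  have hc : (c, g) ∉ M := by
    intro hc
    have hb : (b, g) ∉ M := fun h => not_bc h hc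
    refine hst.false_of_prefersS (by simp [hgb]) (Or.inl (only b hgb hb)) hqr htb
      (undersub_of_forall_notMem (hub q) fun d hd => ?_) hc (by simp [htc]) hbc
    rcases occ d hd with rfl | rfl | rfl
    · exact absurd hd ha
    · exact absurd hd hb
    · simp [htc, hqr, hpq.symm]
  have hb : (b, g) ∈ M := by
    by_contra hb
    have free : ∀ u, J.Undersub M g u := fun u =>
      undersub_of_forall_notMem (hub u) fun d hd => by
        rcases occ d hd with rfl | rfl | rfl <;> contradiction
    exact hst.2 b g ⟨by simp [hgb], Or.inl (only b hgb hb), q, r, hqr, htb,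
      Or.inl ⟨free q, free r⟩⟩
  by_contra hne
  push Not at hne
  refine hst.false_of_prefersS hga (Or.inl fun s hs => ?_) hpq hta
    (undersub_of_forall_notMem (hub p) fun d hd => ?_) hb (by simp [htb]) hab
  · by_cases h : s = g
    · exact ha (h ▸ hs)
    · exact hne s h hs
  · rcases occ d hd with rfl | rfl | rfl
    · exact absurd hd ha
    · simp [htb, hpq, hrp.symm]
    · exact absurd hd hc

end General

end TAPSS

theorem mem_Xlist {a : SApp n m} : a ∈ Xlist n m ↔ ∃ i r, a = .x i r := by
  simp [Xlist, eq_comm]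

theorem mem_Qlist {a : SApp n m} : a ∈ Qlist n m ↔ ∃ j, a = .q j := by
  simp [Qlist, eq_comm]

theorem mem_Wlist {a : SApp n m} : a ∈ Wlist n m ↔ ∃ j t, a = .w j t := by
  simp [Wlist, eq_comm]

section Extended

variable {B : E3SAT n m} {LX1 LX2 LR1 LR2 : List (SApp' n m)}

theorem prefersS_ssOf' {s : SSch' n m} {p : Subj} {a b : SApp' n m} {L₁ L₂ : List (SApp' n m)}
    (hL : ssMaster' n m LX1 LX2 LR1 LR2 p = L₁ ++ L₂) (ha : a ∈ L₁) (hb : b ∈ L₂) (hb' : b ∉ L₁)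
    (hsa : s ∈ ssPrefA' B a) (hpa : p ∈ ssPtype' a)
    (hsb : s ∈ ssPrefA' B b) (hpb : p ∈ ssPtype' b) :
    (ssOf' B LX1 LX2 LR1 LR2).PrefersS s p a b := by
  simp only [TAPSS.PrefersS, ssOf', hL]
  refine ⟨?_, ?_, List.idxOf_filter_append_lt _ ha (by simp [hsa, hpa]) hb'⟩
  · simp [ha, hsa, hpa]
  · simp [hb, hsb, hpb]

theorem g_mem_ssPrefA'_iff {a : SApp n m} {d : SApp' n m} :
    .g a ∈ ssPrefA' B d ↔ d = .base a ∨ d = .p1 a ∨ d = .p2 a := by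
  cases d <;> simp [ssPrefA', eq_comm]

theorem base_mem_ssPrefA'_iff {a : SApp n m} {s : SSch n m} :
    .base s ∈ ssPrefA' B (.base a) ↔ s ∈ ssPrefA B a := by
  simp [ssPrefA']

variable {M' : Finset (SApp' n m × SSch' n m)}

theorem exists_base_mem (hord : ssOrderings n m LX1 LX2 LR1 LR2)
    (hst : (ssOf' B LX1 LX2 LR1 LR2).Stable M') (a : SApp n m) :
    ∃ s ∈ ssPrefA B a, (.base a, .base s) ∈ M' := by
  obtain ⟨h1, h2, h3, h4⟩ := hord
  suffices h : ∃ s, s ≠ .g a ∧ (SApp'.base a, s) ∈ M' by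
    obtain ⟨s, hs, hm⟩ := h
    have hp : s ∈ ssPrefA' B (.base a) := hst.1.1.1 _ hm
    cases s with
    | base s => exact ⟨s, base_mem_ssPrefA'_iff.1 hp, hm⟩
    | g b =>
      rw [g_mem_ssPrefA'_iff] at hp
      simp at hp
      exact absurd (by rw [hp]) hs
  have hga : ∀ a : SApp n m, ∀ d, (d = .base a ∨ d = .p1 a ∨ d = .p2 a) → .g a ∈ ssPrefA' B d :=
    fun a d => g_mem_ssPrefA'_iff.2
  have hF : (ssMaster' n m LX1 LX2 LR1 LR2 .F) =
      (Wlist n m ++ Xlist n m ++ Qlist n m).map SApp'.base ++ (LX1 ++ LR1) := by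
    simp [ssMaster']
  have hcap : ∀ u, (ssOf' B LX1 LX2 LR1 LR2).cap (.g a) u = 1 := fun _ => rfl
  have hg : ∀ d, .g a ∈ (ssOf' B LX1 LX2 LR1 LR2).prefA d → _ :=
    fun d => g_mem_ssPrefA'_iff.1
  by_cases ha : ∃ i r, a = .x i r
  · obtain ⟨i, r, rfl⟩ := ha
    refine hst.exists_ne_of_cyclic (p := .I) (q := .F) (r := .M) (b := .p1 (.x i r))
      (c := .p2 (.x i r)) (by simp) (by simp) (by simp) hcap
      (by simp [ssOf', ssPtype', ssPtype, Finset.pair_comm])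
      (by simp [ssOf', ssPtype']) (by simp [ssOf', ssPtype', Finset.pair_comm])
      (hga _ _ (Or.inl rfl)) rfl rfl hg
      (prefersS_ssOf' hF ?_ ?_ ?_ (hga _ _ (by simp)) ?_ (hga _ _ (by simp)) ?_)
      (prefersS_ssOf' (L₁ := LR2 ++ (Qlist n m ++ (Wlist n m).reverse).map SApp'.base ++ LX1)
        (L₂ := LX2) rfl ?_ ?_ ?_ (hga _ _ (by simp)) ?_ (hga _ _ (by simp)) ?_)
      (prefersS_ssOf' (L₁ := LX2)
        (L₂ := LR1 ++ LR2 ++ ((Xlist n m).reverse).map SApp'.base) (by simp [ssMaster'])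
        ?_ ?_ ?_ (hga _ _ (by simp)) ?_ (hga _ _ (by simp)) ?_) <;>
    simp [h1.mem_iff, h2.mem_iff, h3.mem_iff, h4.mem_iff, mem_Xlist, mem_Qlist, mem_Wlist,
      ssPtype', ssPtype]
  · have hta : ssPtype' (.base a) = {.F, .M} := by cases a <;> simp_all [ssPtype', ssPtype]
    have ht1 : ssPtype' (.p1 a) = {.F, .I} := by cases a <;> simp_all [ssPtype']
    have ht2 : ssPtype' (.p2 a) = {.I, .M} := rfl
    have hR : (∃ j, a = .q j) ∨ ∃ j t, a = .w j t := by cases a <;> simp_all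
    refine hst.exists_ne_of_cyclic (p := .M) (q := .F) (r := .I) (b := .p1 a)
      (c := .p2 a) (by simp) (by simp) (by simp) hcap
      (by simp [ssOf', hta, Finset.pair_comm]) ht1 ht2
      (hga _ _ (Or.inl rfl)) rfl rfl hg
      (prefersS_ssOf' hF ?_ ?_ ?_ (hga _ _ (by simp)) ?_ (hga _ _ (by simp)) ?_)
      (prefersS_ssOf' (L₁ := LX2 ++ LR1)
        (L₂ := LR2 ++ ((Xlist n m).reverse).map SApp'.base) (by simp [ssMaster'])
        ?_ ?_ ?_ (hga _ _ (by simp)) ?_ (hga _ _ (by simp)) ?_)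
      (prefersS_ssOf' (L₁ := LR2)
        (L₂ := (Qlist n m ++ (Wlist n m).reverse).map SApp'.base ++ LX1 ++ LX2)
        (by simp [ssMaster'])
        ?_ ?_ ?_ (hga _ _ (by simp)) ?_ (hga _ _ (by simp)) ?_) <;>
    simp [h1.mem_iff, h2.mem_iff, h3.mem_iff, h4.mem_iff, mem_Xlist, mem_Qlist, mem_Wlist,
      hta, ht1, ht2, hR, hR.symm, ha]

theorem eq_of_base_mem (hst : (ssOf' B LX1 LX2 LR1 LR2).Stable M') {a b : SApp n m} {s : SSch n m}
    (ha : (.base a, .base s) ∈ M') (hb : (.base b, .base s) ∈ M') : a = b := by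
  have hF : ∀ c : SApp n m, Subj.F ∈ ssPtype' (.base c) := fun c => by
    cases c <;> simp [ssPtype', ssPtype]
  have hc : (ssOf' B LX1 LX2 LR1 LR2).cap (.base s) .F ≤ 1 := by
    cases s <;> simp [ssOf', ssCap', ssCap]
  exact SApp'.base.inj (hst.1.eq_of_cap_le_one hc ha hb (hF a) (hF b))

/-- Every position of a clause is occupied by the `q`-applicant or a `w`-applicant of the clause,
and the `q`-applicant does occupy one of them. -/
theorem clause_occupied (hord : ssOrderings n m LX1 LX2 LR1 LR2)
    (hst : (ssOf' B LX1 LX2 LR1 LR2).Stable M') (j : Fin m) :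
    ∃ t, (.base (.q j), .base (.s j t)) ∈ M' ∧
      ∀ t' ≠ t, (.base (.w j t'), .base (.s j t')) ∈ M' := by
  obtain ⟨s, hs, hq⟩ := exists_base_mem hord hst (.q j)
  have hw : ∀ t, (.base (.w j t), .base (.s j t)) ∈ M' ∨
      (.base (.w j t), .base (.s4 j)) ∈ M' := by
    intro t
    obtain ⟨s', hs', hw⟩ := exists_base_mem hord hst (.w j t)
    simp only [ssPrefA, List.mem_cons, List.not_mem_nil, or_false] at hs'
    rcases hs' with rfl | rfl
    · exact Or.inl hw
    · exact Or.inr hw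
  obtain ⟨t, rfl⟩ : ∃ t, s = .s j t := by
    simp only [ssPrefA, List.mem_cons, List.not_mem_nil, or_false] at hs
    rcases hs with rfl | rfl | rfl <;> exact ⟨_, rfl⟩
  refine ⟨t, hq, fun t' ht => (hw t').resolve_right fun h' => ?_⟩
  rcases hw t with h | h
  · have := eq_of_base_mem hst hq h
    simp at this
  · have := eq_of_base_mem hst h' h
    simp at this
    exact ht this

theorem x_not_mem_clause (hord : ssOrderings n m LX1 LX2 LR1 LR2)
    (hst : (ssOf' B LX1 LX2 LR1 LR2).Stable M') (i : Fin n) (r : Fin 4) (j : Fin m) (t : Fin 3) :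
    (.base (.x i r), .base (.s j t)) ∉ M' := by
  intro hx
  obtain ⟨t', hq, hw⟩ := clause_occupied hord hst j
  by_cases h : t = t'
  · subst h
    have := eq_of_base_mem hst hq hx
    simp at this
  · have := eq_of_base_mem hst (hw t h) hx
    simp at this

/-- The index of the `y`-school at the head of the preference list of `x i r`. -/
def firstY (r : Fin 4) : Fin 4 := ![0, 1, 3, 0] r

/-- The index of the `y`-school at the end of the preference list of `x i r` in `J`. -/
def lastY (r : Fin 4) : Fin 4 := ![1, 2, 2, 3] r

theorem ssPrefA_x (B : E3SAT n m) (i : Fin n) (r : Fin 4) :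
    ssPrefA B (.x i r) = [.y i (firstY r), sx B i r, .y i (lastY r)] := by
  fin_cases r <;> rfl

theorem exists_sx_eq (B : E3SAT n m) (i : Fin n) (r : Fin 4) : ∃ j t, sx B i r = .s j t := by
  unfold sx
  split <;> exact ⟨_, _, rfl⟩

theorem x_mem_firstY_or_lastY (hord : ssOrderings n m LX1 LX2 LR1 LR2)
    (hst : (ssOf' B LX1 LX2 LR1 LR2).Stable M') (i : Fin n) (r : Fin 4) :
    (.base (.x i r), .base (.y i (firstY r))) ∈ M' ∨
      (.base (.x i r), .base (.y i (lastY r))) ∈ M' := by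
  obtain ⟨s, hs, hx⟩ := exists_base_mem hord hst (.x i r)
  rw [ssPrefA_x] at hs
  simp only [List.mem_cons, List.not_mem_nil, or_false] at hs
  rcases hs with rfl | rfl | rfl
  · exact Or.inl hx
  · obtain ⟨j, t, h⟩ := exists_sx_eq B i r
    rw [h] at hx
    exact absurd hx (x_not_mem_clause hord hst i r j t)
  · exact Or.inr hx

/-- An `x`-applicant at its least preferred school would move to the place held by a
`q`-applicant. -/
theorem x_not_mem_lastY (hst : (ssOf' B LX1 LX2 LR1 LR2).Stable M')
    {i : Fin n} {r : Fin 4} {j : Fin m} {t : Fin 3} (hsx : sx B i r = .s j t)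
    (hq : (.base (.q j), .base (.s j t)) ∈ M') :
    (.base (.x i r), .base (.y i (lastY r))) ∉ M' := by
  intro hx
  have hpref : ssPrefA' B (.base (.x i r)) = [.base (.y i (firstY r)), .base (.s j t),
      .base (.y i (lastY r)), .g (.x i r)] := by
    simp [ssPrefA', ssPrefA_x, hsx]
  have hmove : (ssOf' B LX1 LX2 LR1 LR2).PrefersA (.base (.x i r)) (.base (.s j t))
      (.base (.y i (lastY r))) := by
    have : firstY r ≠ lastY r := by fin_cases r <;> decide
    simp only [TAPSS.PrefersA, ssOf', hpref]
    simp [this]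
  refine hst.false_of_prefersS (p := .I) (q := .F) (s := .base (.s j t)) hmove.1
    (Or.inr ⟨_, hx, hmove⟩) (by simp) (by simp [ssOf', ssPtype', ssPtype, Finset.pair_comm])
    (TAPSS.undersub_of_forall_notMem (by simp [ssOf', ssCap', ssCap]) fun d hd => ?_) hq
    (by simp [ssOf', ssPtype', ssPtype])
    (prefersS_ssOf' (L₁ := (Wlist n m ++ Xlist n m).map SApp'.base)
      (L₂ := (Qlist n m).map SApp'.base ++ (LX1 ++ LR1)) (by simp [ssMaster']) ?_ ?_ ?_
      hmove.1 (by simp [ssPtype', ssPtype]) (hst.1.1.1 _ hq) (by simp [ssPtype', ssPtype]))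
  · have hd' : .base (.s j t) ∈ ssPrefA' B d := hst.1.1.1 _ hd
    cases d with
    | base d =>
      obtain rfl := eq_of_base_mem hst hd hq
      simp [ssOf', ssPtype', ssPtype]
    | p1 d => simp [ssPrefA'] at hd'
    | p2 d => simp [ssPrefA'] at hd'
  all_goals simp [mem_Xlist, mem_Qlist, mem_Wlist]

/-- The four `x`-applicants of a variable either all sit clockwise or all sit anticlockwise
around the four `y`-schools: an applicant of the positive literal and one of the negative
literal do not both get their favourite school. -/
theorem not_firstY_firstY (hord : ssOrderings n m LX1 LX2 LR1 LR2)
    (hst : (ssOf' B LX1 LX2 LR1 LR2).Stable M') {i : Fin n} {r r' : Fin 4}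
    (hr : r.1 < 2) (hr' : ¬ r'.1 < 2) (h : (.base (.x i r), .base (.y i (firstY r))) ∈ M')
    (h' : (.base (.x i r'), .base (.y i (firstY r'))) ∈ M') : False := by
  have key : ∀ {a b : Fin 4} {k : Fin 4}, (.base (.x i a), .base (.y i k)) ∈ M' →
      (.base (.x i b), .base (.y i k)) ∈ M' → a = b := fun ha hb => by
    simpa using eq_of_base_mem hst ha hb
  have h0 := x_mem_firstY_or_lastY hord hst i 0
  have h3 := x_mem_firstY_or_lastY hord hst i 3
  have hr2 : r = 0 ∨ r = 1 := by omega
  have hr2' : r' = 2 ∨ r' = 3 := by omega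
  rcases hr2 with rfl | rfl <;> rcases hr2' with rfl | rfl
  · rcases h3 with h3 | h3
    · exact absurd (key h h3) (by decide)
    · exact absurd (key h' h3) (by decide)
  · exact absurd (key h h') (by decide)
  · rcases h0 with h0 | h0
    · rcases h3 with h3 | h3
      · exact absurd (key h0 h3) (by decide)
      · exact absurd (key h' h3) (by decide)
    · exact absurd (key h0 h) (by decide)
  · rcases h0 with h0 | h0
    · exact absurd (key h0 h') (by decide)
    · exact absurd (key h0 h) (by decide)

end Extended

/-- The index within its variable of the `x`-applicant of a literal occurrence. -/
def occIndex (b : Bool) (o : Fin 2) : Fin 4 :=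
  if b then ⟨o.1, by omega⟩ else ⟨o.1 + 2, by omega⟩

theorem sx_occIndex (B : E3SAT n m) (i : Fin n) (b : Bool) (o : Fin 2) :
    sx B i (occIndex b o) = .s (B.occurs i b o).1 (B.occurs i b o).2 := by
  cases b <;> fin_cases o <;> rfl

theorem occIndex_lt_two_iff (b : Bool) (o : Fin 2) : (occIndex b o).1 < 2 ↔ b = true := by
  cases b <;> fin_cases o <;> decide

theorem stmt14 {n m : ℕ} (B : E3SAT n m) (LX1 LX2 LR1 LR2 : List (SApp' n m))
    (hord : ssOrderings n m LX1 LX2 LR1 LR2)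
    (M' : Finset (SApp' n m × SSch' n m))
    (hst : (ssOf' B LX1 LX2 LR1 LR2).Stable M') :
    ∃ f : Fin n → Bool, B.Satisfies f := by
  classical
  refine ⟨fun i => decide (∃ r : Fin 4, r.1 < 2 ∧
    (.base (.x i r), .base (.y i (firstY r))) ∈ M'), fun j => ?_⟩
  obtain ⟨t, hq, -⟩ := clause_occupied hord hst j
  obtain ⟨v, b, o, hocc⟩ : ∃ v b o, B.occurs v b o = (j, t) := ⟨_, _, _, B.occurs_occInv j t⟩
  have hcl := B.clause_occurs v b o
  have hsx := sx_occIndex B v b o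
  rw [hocc] at hcl hsx
  have hx := (x_mem_firstY_or_lastY hord hst v (occIndex b o)).resolve_right
    (x_not_mem_lastY hst hsx hq)
  have hb := occIndex_lt_two_iff b o
  refine ⟨t, ?_⟩
  rw [hcl]
  cases b with
  | true => exact decide_eq_true ⟨_, hb.2 rfl, hx⟩
  | false =>
    refine decide_eq_false ?_
    rintro ⟨r, hr, hr'⟩
    exact not_firstY_firstY hord hst hr (fun h => by simpa using hb.1 h) hr' hx
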